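/- (Split conformal approximates the oracle width) Under A0, A1, and A2 (P(||μ̂_n - μ̃||_∞ ≥ η_n) ≤ ρ_n), if the density of |Y - μ̃(X)| is bounded away from zero in an open neighborhood of its α upper quantile, then the width ν_{n,split} of the split conformal interval satisfies ν_{n,split} - 2q_{n,α} = O_P(ρ_n + η_n + n^{-1/2}), where q_{n,α} is the α upper quantile of |Y - μ̂_n(X)| (the oracle half-width). -/

import Mathlib

open MeasureTheory Finset Filter

open scoped Classical ENNReal

/-- The `k`-th smallest value (1-indexed) of `v` over the finite index set `s`. -/
noncomputable def kthSmallest {ι : Type*} (s : Finset ι) (v : ι → ℝ) (k : ℕ) : ℝ :=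
  sInf {t : ℝ | k ≤ (s.filter fun i => v i ≤ t).card}

section OrderStatistics

variable {ι : Type*} {s : Finset ι} {v : ι → ℝ} {k : ℕ} {t : ℝ}

theorem bddBelow_setOf_le_card_filter (hk : 1 ≤ k) :
    BddBelow {t : ℝ | k ≤ (s.filter fun i => v i ≤ t).card} := by
  obtain ⟨m, hm⟩ := (s.image v).bddBelow
  refine ⟨m, fun t ht => ?_⟩
  obtain ⟨i, hi⟩ := Finset.card_pos.mp (hk.trans ht)
  rw [Finset.mem_filter] at hi
  exact (hm (by simpa using ⟨i, hi.1, rfl⟩)).trans hi.2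

theorem kthSmallest_le_of_le_card (hk : 1 ≤ k) (h : k ≤ (s.filter fun i => v i ≤ t).card) :
    kthSmallest s v k ≤ t :=
  csInf_le (bddBelow_setOf_le_card_filter hk) h

theorem le_kthSmallest_of_card_lt (hk : k ≤ s.card) (h : (s.filter fun i => v i ≤ t).card < k) :
    t ≤ kthSmallest s v k := by
  apply le_csInf
  · obtain ⟨m, hm⟩ := (s.image v).bddAbove
    refine ⟨m, ?_⟩
    rw [Set.mem_ofPred_eq, Finset.filter_true_of_mem]
    · exact hk
    · exact fun i hi => hm (by simpa using ⟨i, hi, rfl⟩)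
  · intro u hu
    by_contra! hut
    refine absurd (hu.trans (Finset.card_le_card ?_)) (not_le.mpr h)
    exact Finset.monotone_filter_right s fun i _ hi => hi.trans hut.le

end OrderStatistics

section SampleHalves

variable {S : Type*} [MeasurableSpace S] (P : Measure S) [IsProbabilityMeasure P] (m n : ℕ)

theorem map_pi_castAdd :
    (Measure.pi fun _ : Fin (m + n) => P).map (fun w k => w (Fin.castAdd n k))
      = Measure.pi fun _ : Fin m => P := by
  symm
  refine Measure.pi_eq fun B hB => ?_
  rw [Measure.map_apply (by fun_prop) (.univ_pi hB)]
  have : (fun (w : Fin (m + n) → S) k => w (Fin.castAdd n k)) ⁻¹' Set.univ.pi B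
      = Set.univ.pi (Fin.append B fun _ => Set.univ) := by
    ext w
    simp [Set.mem_pi, Fin.forall_fin_add]
  rw [this, Measure.pi_pi, Fin.prod_univ_add]
  simp

theorem map_pi_natAdd :
    (Measure.pi fun _ : Fin (m + n) => P).map (fun w k => w (Fin.natAdd m k))
      = Measure.pi fun _ : Fin n => P := by
  symm
  refine Measure.pi_eq fun B hB => ?_
  rw [Measure.map_apply (by fun_prop) (.univ_pi hB)]
  have : (fun (w : Fin (m + n) → S) k => w (Fin.natAdd m k)) ⁻¹' Set.univ.pi B
      = Set.univ.pi (Fin.append (fun _ => Set.univ) B) := by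
    ext w
    simp [Set.mem_pi, Fin.forall_fin_add]
  rw [this, Measure.pi_pi, Fin.prod_univ_add]
  simp

theorem pi_preimage_castAdd_le (B : Set (Fin m → S)) :
    (Measure.pi fun _ : Fin (m + n) => P) {w | (fun k => w (Fin.castAdd n k)) ∈ B}
      ≤ (Measure.pi fun _ : Fin m => P) B := by
  have hmeas : Measurable fun (w : Fin (m + n) → S) k => w (Fin.castAdd n k) := by fun_prop
  rw [← map_pi_castAdd P m n]
  exact Measure.le_map_apply hmeas.aemeasurable B

theorem pi_preimage_natAdd_le (B : Set (Fin n → S)) :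
    (Measure.pi fun _ : Fin (m + n) => P) {w | (fun k => w (Fin.natAdd m k)) ∈ B}
      ≤ (Measure.pi fun _ : Fin n => P) B := by
  have hmeas : Measurable fun (w : Fin (m + n) → S) k => w (Fin.natAdd m k) := by fun_prop
  rw [← map_pi_natAdd P m n]
  exact Measure.le_map_apply hmeas.aemeasurable B

variable {n} in
/-- Chebyshev's inequality for the number of sample points falling in a measurable set. -/
theorem pi_le_abs_card_filter_sub {B : Set S} (hB : MeasurableSet B) {c : ℝ} (hc : 0 < c) :
    (Measure.pi fun _ : Fin n => P)
        {w | c ≤ |((Finset.univ.filter fun k => w k ∈ B).card : ℝ) - n * P.real B|}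
      ≤ ENNReal.ofReal (n / 4 / c ^ 2) := by
  have hmeas : Measurable (B.indicator (1 : S → ℝ)) := measurable_one.indicator hB
  have hmem : MemLp (B.indicator (1 : S → ℝ)) 2 P :=
    MemLp.of_bound hmeas.aestronglyMeasurable 1
      (.of_forall fun x => by by_cases h : x ∈ B <;> simp [h])
  have hmem_eval : ∀ i : Fin n, MemLp (fun w : Fin n → S => B.indicator (1 : S → ℝ) (w i)) 2
      (Measure.pi fun _ : Fin n => P) := fun i =>
    hmem.comp_measurePreserving (measurePreserving_eval (fun _ : Fin n => P) i)
  have hsum : MemLp (∑ i : Fin n, fun w : Fin n → S => B.indicator (1 : S → ℝ) (w i)) 2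
      (Measure.pi fun _ : Fin n => P) := memLp_finsetSum' _ fun i _ => hmem_eval i
  have hvar : ProbabilityTheory.variance
      (∑ i : Fin n, fun w : Fin n → S => B.indicator (1 : S → ℝ) (w i))
      (Measure.pi fun _ : Fin n => P) ≤ n / 4 := by
    rw [ProbabilityTheory.variance_sum_pi fun _ => hmem]
    have := ProbabilityTheory.variance_le_sq_of_bounded (μ := P) (a := 0) (b := 1)
      (X := B.indicator (1 : S → ℝ))
      (.of_forall fun x => by by_cases h : x ∈ B <;> simp [h]) hmeas.aemeasurable
    simp only [Finset.sum_const, Finset.card_univ, Fintype.card_fin, nsmul_eq_mul]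
    nlinarith [(Nat.cast_nonneg n : (0 : ℝ) ≤ n)]
  have hmean : ∫ w, (∑ i : Fin n, fun w : Fin n → S => B.indicator (1 : S → ℝ) (w i)) w
      ∂(Measure.pi fun _ : Fin n => P) = n * P.real B := by
    simp only [Finset.sum_apply]
    rw [integral_finsetSum _ fun i _ => (hmem_eval i).integrable one_le_two]
    have : ∀ i : Fin n, ∫ w, B.indicator (1 : S → ℝ) (w i) ∂(Measure.pi fun _ : Fin n => P)
        = P.real B := fun i => by
      have := integral_map (measurable_pi_apply i).aemeasurable
        (μ := Measure.pi fun _ : Fin n => P) hmeas.aestronglyMeasurable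
      rw [← integral_indicator_one hB]
      exact this.symm.trans
        (by rw [(measurePreserving_eval (fun _ : Fin n => P) i).map_eq])
    simp [this]
  have hcard : ∀ w : Fin n → S, ((Finset.univ.filter fun k => w k ∈ B).card : ℝ)
      = (∑ i : Fin n, fun w : Fin n → S => B.indicator (1 : S → ℝ) (w i)) w := fun w => by
    simp [Finset.sum_apply, Set.indicator_apply]
  have := ProbabilityTheory.meas_ge_le_variance_div_sq hsum hc
  rw [hmean] at this
  simp only [hcard]
  exact this.trans (ENNReal.ofReal_le_ofReal (by gcongr))

end SampleHalves

section PredictionBand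

variable {E Ω : Type*}

theorem abs_sub_le_of_abs_sub_lt {x y z a b : ℝ} (hxy : |x - y| < a) (h : |z - y| ≤ b) :
    |z - x| ≤ b + a := by
  have := abs_sub_le z y x
  rw [abs_sub_comm x y] at hxy
  linarith

variable [MeasurableSpace E] [MeasurableSpace Ω]

theorem prod_real_setOf_fst_mem (ν : Measure Ω) (P : Measure (E × ℝ)) [IsProbabilityMeasure P]
    (B : Set Ω) :
    (ν.prod P).real {p | p.1 ∈ B} = ν.real B := by
  have : {p : Ω × E × ℝ | p.1 ∈ B} = B ×ˢ Set.univ := by ext; simp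
  simp [Measure.real, this, Measure.prod_prod]

variable (ν : Measure Ω) [IsProbabilityMeasure ν] (P : Measure (E × ℝ)) [IsProbabilityMeasure P]
  {fit : Ω → E → ℝ} {g : E → ℝ} {η ρ : ℝ}

theorem prod_real_setOf_snd_mem (B : Set (E × ℝ)) :
    (ν.prod P).real {p | p.2 ∈ B} = P.real B := by
  have : {p : Ω × E × ℝ | p.2 ∈ B} = Set.univ ×ˢ B := by ext; simp
  simp [Measure.real, this, Measure.prod_prod]

/-- If `fit` is `η`-close to `g` off an event of probability `ρ`, its residual distribution
function dominates a shift of that of `g`, up to `ρ`. -/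
theorem residual_cdf_le_fit (hρ : 0 ≤ ρ)
    (h : ν {w | ¬ ∀ x, |fit w x - g x| < η} ≤ ENNReal.ofReal ρ) (t : ℝ) :
    P.real {q | |q.2 - g q.1| ≤ t}
      ≤ (ν.prod P).real {p | |p.2.2 - fit p.1 p.2.1| ≤ t + η} + ρ := by
  have hB : ν.real {w | ¬ ∀ x, |fit w x - g x| < η} ≤ ρ := ENNReal.toReal_le_of_le_ofReal hρ h
  rw [← prod_real_setOf_fst_mem ν P] at hB
  rw [← prod_real_setOf_snd_mem ν P]
  refine (measureReal_mono (fun p hp => ?_)).trans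
    ((measureReal_union_le _ _).trans (add_le_add_right hB _))
  by_cases hw : ∀ x, |fit p.1 x - g x| < η
  · exact .inl (abs_sub_le_of_abs_sub_lt (hw p.2.1) hp)
  · exact .inr hw

theorem fit_residual_cdf_le (hρ : 0 ≤ ρ)
    (h : ν {w | ¬ ∀ x, |fit w x - g x| < η} ≤ ENNReal.ofReal ρ) (t : ℝ) :
    (ν.prod P).real {p | |p.2.2 - fit p.1 p.2.1| ≤ t}
      ≤ P.real {q | |q.2 - g q.1| ≤ t + η} + ρ := by
  have hB : ν.real {w | ¬ ∀ x, |fit w x - g x| < η} ≤ ρ := ENNReal.toReal_le_of_le_ofReal hρ h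
  rw [← prod_real_setOf_fst_mem ν P] at hB
  rw [← prod_real_setOf_snd_mem ν P]
  refine (measureReal_mono (fun p hp => ?_)).trans
    ((measureReal_union_le _ _).trans (add_le_add_right hB _))
  by_cases hw : ∀ x, |fit p.1 x - g x| < η
  · exact .inl (abs_sub_le_of_abs_sub_lt ((abs_sub_comm _ _).trans_lt (hw p.2.1)) hp)
  · exact .inr hw

/-- The oracle half-width is close to the quantile of `|Y - g(X)|`. -/
theorem abs_oracle_quantile_sub_le (hρ : 0 ≤ ρ)
    (h : ν {w | ¬ ∀ x, |fit w x - g x| < η} ≤ ENNReal.ofReal ρ)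
    {r δ q₀ q β a : ℝ} (hr : 0 < r) (ha : 0 < a)
    (hq₀ : P.real {q | |q.2 - g q.1| ≤ q₀} = β)
    (hdens : ∀ s t : ℝ, q₀ - δ ≤ s → s ≤ t → t ≤ q₀ + δ → r * (t - s)
      ≤ P.real {q | |q.2 - g q.1| ≤ t} - P.real {q | |q.2 - g q.1| ≤ s})
    (hq : (ν.prod P).real {p | |p.2.2 - fit p.1 p.2.1| ≤ q} = β)
    (hsmall : ρ / r + a ≤ δ) :
    |q - q₀| ≤ η + ρ / r + a := by
  have hρr : 0 ≤ ρ / r := by positivity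
  have hρr' : r * (ρ / r) = ρ := by field_simp
  have hra : 0 < r * a := by positivity
  rw [abs_sub_le_iff]
  constructor <;> by_contra! hlt
  · have h1 := residual_cdf_le_fit ν P hρ h (q₀ + (ρ / r + a))
    have h2 := hdens q₀ (q₀ + (ρ / r + a)) (by linarith) (by linarith) (by linarith)
    have h3 : (ν.prod P).real {p | |p.2.2 - fit p.1 p.2.1| ≤ q₀ + (ρ / r + a) + η}
        ≤ (ν.prod P).real {p | |p.2.2 - fit p.1 p.2.1| ≤ q} :=
      measureReal_mono (Set.ofPred_subset_ofPred.mpr fun p hp => hp.trans (by linarith))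
    nlinarith
  · have h1 := fit_residual_cdf_le ν P hρ h q
    have h2 := hdens (q₀ - (ρ / r + a)) q₀ (by linarith) (by linarith) (by linarith)
    have h3 : P.real {p | |p.2 - g p.1| ≤ q + η}
        ≤ P.real {q | |q.2 - g q.1| ≤ q₀ - (ρ / r + a)} :=
      measureReal_mono (Set.ofPred_subset_ofPred.mpr fun p hp => hp.trans (by linarith))
    nlinarith

end PredictionBand

theorem measurable_of_stable {E F : Type*} [MeasurableSpace E] [MeasurableSpace F]
    {P : Measure F} [IsProbabilityMeasure P] {A : (n : ℕ) → (Fin n → F) → E → ℝ}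
    (hA : ∀ n, Measurable fun p : (Fin n → F) × E => A n p.1 p.2)
    {g : E → ℝ} {η ρ : ℕ → ℝ} (hη : Tendsto η atTop (nhds 0)) (hρ : Tendsto ρ atTop (nhds 0))
    (hstab : ∀ᶠ n in atTop,
      (Measure.pi fun _ : Fin n => P) {w | ¬ ∀ x, |A n w x - g x| < η n}
        ≤ ENNReal.ofReal (ρ n)) :
    Measurable g := by
  have hex : ∀ᶠ n in atTop, ∃ w, ∀ x, |A n w x - g x| < η n := by
    filter_upwards [hstab, hρ.eventually_lt_const one_pos] with n hn hρn
    by_contra! hne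
    have huniv : {w | ¬ ∀ x, |A n w x - g x| < η n} = Set.univ := by
      ext w
      simpa using hne w
    rw [huniv, measure_univ, ENNReal.one_le_ofReal] at hn
    linarith
  obtain ⟨N, hN⟩ := eventually_atTop.mp hex
  choose w hw using fun n : ℕ => hN (n + N) (Nat.le_add_left N n)
  refine measurable_of_tendsto_metrizable (f := fun n => A (n + N) (w n))
    (fun n => (hA (n + N)).comp (measurable_const.prodMk measurable_id)) ?_
  rw [tendsto_pi_nhds]
  intro x
  rw [tendsto_iff_dist_tendsto_zero]
  exact squeeze_zero (fun _ => dist_nonneg) (fun n => (hw n x).le)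
    (hη.comp (tendsto_add_atTop_nat N))

/-- Split conformal approximates the oracle width: under A0 (i.i.d.
data, `Y = μ(X) + ε`), A1 (ε independent of X with symmetric density nonincreasing
on `[0,∞)`), and A2 (sampling stability `P(‖μ̂_n - μ̃‖_∞ ≥ η_n) ≤ ρ_n`,
`η_n, ρ_n = o(1)`), if the density of `|Y - μ̃(X)|` is bounded below (by `r`, in an
increment form of the CDF `F̃`) in an open neighborhood of its α upper quantile
`q̃`, then the width `ν_{n,split}` of the split conformal interval (fit on `n` of
the `2n` samples, ranked on the other `n`) satisfies
`ν_{n,split} - 2q_{n,α} = O_P(ρ_n + η_n + n^{-1/2})`, where `q_{n,α}` is the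
α upper quantile of `|Y - μ̂_n(X)|` for an independent `(X,Y)` (the oracle
half-width). -/
theorem split_conformal_oracle_width
    {E : Type*} [MeasurableSpace E]
    (Px : Measure E) [IsProbabilityMeasure Px]
    (Pe : Measure ℝ) [IsProbabilityMeasure Pe]
    (μReg : E → ℝ) (hmreg : Measurable μReg)
    (f₀ : ℝ → ℝ)
    (hPe : Pe = volume.withDensity fun t => ENNReal.ofReal (f₀ t))
    (hsymm : ∀ t, f₀ (-t) = f₀ t)
    (hmono : AntitoneOn f₀ (Set.Ici (0 : ℝ)))
    (P : Measure (E × ℝ))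
    (hP : P = Measure.map (fun q : E × ℝ => (q.1, μReg q.1 + q.2)) (Px.prod Pe))
    (A : (n : ℕ) → (Fin n → E × ℝ) → E → ℝ)
    (hA : ∀ n, Measurable fun p : (Fin n → E × ℝ) × E => A n p.1 p.2)
    (μtil : E → ℝ) (η ρ : ℕ → ℝ)
    (hη : Tendsto η atTop (nhds 0)) (hρ : Tendsto ρ atTop (nhds 0))
    (hηnn : ∀ n, 0 ≤ η n) (hρnn : ∀ n, 0 ≤ ρ n)
    (hstab : ∀ᶠ n in atTop,
      (Measure.pi fun _ : Fin n => P) {w | ¬ ∀ x, |A n w x - μtil x| < η n}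
        ≤ ENNReal.ofReal (ρ n))
    (α : ℝ) (hα : α ∈ Set.Ioo (0 : ℝ) 1)
    (r δ qtil : ℝ) (hr : 0 < r) (hδ : 0 < δ)
    -- q̃ is the α upper quantile of |Y - μ̃(X)| :
    (hqtil : (P {q : E × ℝ | |q.2 - μtil q.1| ≤ qtil}).toReal = 1 - α)
    -- density of |Y - μ̃(X)| bounded below by r in an open neighborhood of q̃ :
    (hdens : ∀ s t : ℝ, qtil - δ ≤ s → s ≤ t → t ≤ qtil + δ →
      r * (t - s) ≤ (P {q : E × ℝ | |q.2 - μtil q.1| ≤ t}).toReal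
        - (P {q : E × ℝ | |q.2 - μtil q.1| ≤ s}).toReal)
    -- q n is the α upper quantile of |Y - μ̂_n(X)|, (X,Y) an independent draw :
    (q : ℕ → ℝ)
    (hq : ∀ n, (((Measure.pi fun _ : Fin n => P).prod P)
        {p : (Fin n → E × ℝ) × E × ℝ | |p.2.2 - A n p.1 p.2.1| ≤ q n}).toReal = 1 - α) :
    -- O_P statement: ν_{n,split} - 2 q_{n,α} = O_P(ρ_n + η_n + n^{-1/2})
    ∀ ε : ℝ, 0 < ε → ∃ C : ℝ, 0 < C ∧ ∀ᶠ n in atTop,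
      (Measure.pi fun _ : Fin (n + n) => P)
          {w | let fit : E → ℝ := A n (fun k : Fin n => w (Fin.castAdd n k));
               let width : ℝ := 2 * kthSmallest Finset.univ
                   (fun k : Fin n =>
                     |(w (Fin.natAdd n k)).2 - fit (w (Fin.natAdd n k)).1|)
                   ⌈((n : ℝ) + 1) * (1 - α)⌉₊;
               C * (ρ n + η n + (n : ℝ) ^ (-(1 : ℝ) / 2)) < |width - 2 * q n|}
        ≤ ENNReal.ofReal ε := by
  intro ε hε
  have : IsProbabilityMeasure P := by
    rw [hP]
    exact Measure.isProbabilityMeasure_map (by fun_prop)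
  have hg : Measurable μtil := measurable_of_stable hA hη hρ hstab
  have hresid : ∀ t, MeasurableSet {q : E × ℝ | |q.2 - μtil q.1| ≤ t} := fun t =>
    measurableSet_le (by fun_prop) measurable_const
  obtain ⟨hα0, hα1⟩ := hα
  obtain ⟨K, hK⟩ : ∃ K : ℝ, K = 1 + 1 / ε := ⟨_, rfl⟩
  obtain ⟨M, hM⟩ : ∃ M : ℝ, M = (K + 1) / r := ⟨_, rfl⟩
  have hKpos : 0 < K := by rw [hK]; positivity
  have hMpos : 0 < M := by rw [hM]; positivity
  have hrM : r * M = K + 1 := by rw [hM]; field_simp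
  refine ⟨2 * (2 + (M + 1) + 1 / r), by positivity, ?_⟩
  have ha0 : Tendsto (fun n : ℕ => (n : ℝ) ^ (-(1 : ℝ) / 2)) atTop (nhds 0) := by
    simp only [neg_div]
    exact (tendsto_rpow_neg_atTop (by norm_num)).comp tendsto_natCast_atTop_atTop
  have hsmall : Tendsto (fun n => ρ n / r + (n : ℝ) ^ (-(1 : ℝ) / 2)) atTop (nhds 0) := by
    simpa using (hρ.div_const r).add ha0
  have hsmall' : Tendsto (fun n : ℕ => M * (n : ℝ) ^ (-(1 : ℝ) / 2)) atTop (nhds 0) := by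
    simpa using ha0.const_mul M
  filter_upwards [hstab, hsmall.eventually_le_const hδ, hsmall'.eventually_le_const hδ,
    hρ.eventually_le_const (show 0 < ε / 3 by positivity), eventually_ge_atTop 1,
    tendsto_natCast_atTop_atTop.eventually_ge_atTop (1 / α)]
    with n hn hsn hsn' hρn hn1 hnα
  have hnpos : (0 : ℝ) < n := by exact_mod_cast hn1
  have hn1' : (1 : ℝ) ≤ n := by exact_mod_cast hn1
  set a : ℝ := (n : ℝ) ^ (-(1 : ℝ) / 2) with ha
  have hapos : 0 < a := Real.rpow_pos_of_pos hnpos _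
  have haa : n * a ^ 2 = 1 := by
    rw [ha, ← Real.rpow_natCast, ← Real.rpow_mul hnpos.le]
    norm_num [Real.rpow_neg_one, hnpos.ne']
  have hna : 1 ≤ n * a := by
    have : a ≤ 1 := Real.rpow_le_one_of_one_le_of_nonpos hn1' (by norm_num)
    nlinarith
  set k : ℕ := ⌈((n : ℝ) + 1) * (1 - α)⌉₊ with hk
  have hk1 : 1 ≤ k := Nat.one_le_ceil_iff.mpr (by nlinarith)
  have hkn : k ≤ n := by
    rw [hk, Nat.ceil_le]
    rw [div_le_iff₀ hα0] at hnα
    nlinarith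
  have horacle := abs_oracle_quantile_sub_le _ P (hρnn n) hn hr hapos hqtil hdens
    (hq n) hsn
  set band : ℝ → Set (E × ℝ) := fun t => {q | |q.2 - μtil q.1| ≤ t}
  let dev (t : ℝ) : Set (Fin n → E × ℝ) :=
    {w | n * a * K ≤ |((Finset.univ.filter fun k => w k ∈ band t).card : ℝ)
      - n * P.real (band t)|}
  have hdev : ∀ t, (Measure.pi fun _ : Fin n => P) (dev t) ≤ ENNReal.ofReal (ε / 3) := fun t => by
    refine (pi_le_abs_card_filter_sub P (hresid t) (by positivity)).trans
      (ENNReal.ofReal_le_ofReal ?_)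
    have hsq : (n * a * K) ^ 2 = n * K ^ 2 := by
      linear_combination (n : ℝ) * K ^ 2 * haa
    have hεK : 1 ≤ ε * K ^ 2 := by
      have : ε * K = ε + 1 := by rw [hK]; field_simp
      have hK1 : 1 ≤ K := by rw [hK]; linarith [one_div_pos.mpr hε]
      nlinarith
    rw [hsq, div_le_iff₀ (by positivity)]
    nlinarith
  have hupper := hdens qtil (qtil + M * a) (by linarith) (by nlinarith) (by linarith)
  have hlower := hdens (qtil - M * a) qtil (by linarith) (by nlinarith) (by linarith)
  have hrMa : r * (M * a) = (K + 1) * a := by rw [← hrM]; ring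
  rw [add_sub_cancel_left, hqtil, hrMa] at hupper
  rw [sub_sub_cancel, hqtil, hrMa] at hlower
  have hupper' : (n : ℝ) * ((K + 1) * a) ≤ n * (P.real (band (qtil + M * a)) - (1 - α)) :=
    mul_le_mul_of_nonneg_left hupper hnpos.le
  have hlower' : (n : ℝ) * ((K + 1) * a) ≤ n * (1 - α - P.real (band (qtil - M * a))) :=
    mul_le_mul_of_nonneg_left hlower hnpos.le
  have hsub : {w : Fin (n + n) → E × ℝ |
      let fit : E → ℝ := A n (fun k : Fin n => w (Fin.castAdd n k))
      let width : ℝ := 2 * kthSmallest Finset.univ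
        (fun k : Fin n => |(w (Fin.natAdd n k)).2 - fit (w (Fin.natAdd n k)).1|) k
      2 * (2 + (M + 1) + 1 / r) * (ρ n + η n + a) < |width - 2 * q n|}
      ⊆ {w | (fun k => w (Fin.castAdd n k)) ∈ {w | ¬ ∀ x, |A n w x - μtil x| < η n}}
        ∪ {w | (fun k => w (Fin.natAdd n k)) ∈ dev (qtil + M * a)}
        ∪ {w | (fun k => w (Fin.natAdd n k)) ∈ dev (qtil - M * a)} := by
    intro w hw
    by_contra hbad
    simp only [Set.mem_union, Set.mem_ofPred_eq, not_or, not_not, dev, not_le] at hbad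
    obtain ⟨⟨hclose, hdevU⟩, hdevL⟩ := hbad
    rw [Set.mem_ofPred_eq] at hw
    refine absurd hw (not_lt.mpr ?_)
    set fit : E → ℝ := A n (fun k : Fin n => w (Fin.castAdd n k))
    set v : Fin n → ℝ := fun k => |(w (Fin.natAdd n k)).2 - fit (w (Fin.natAdd n k)).1|
    have hU : kthSmallest Finset.univ v k ≤ qtil + M * a + η n := by
      refine kthSmallest_le_of_le_card hk1 (le_trans ?_ (Finset.card_le_card
        (Finset.monotone_filter_right (p := fun k => w (Fin.natAdd n k) ∈ band (qtil + M * a))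
          _ fun i _ hi => abs_sub_le_of_abs_sub_lt (hclose _) hi)))
      rw [hk, Nat.ceil_le]
      linarith [(abs_lt.mp hdevU).1]
    have hL : qtil - M * a - η n ≤ kthSmallest Finset.univ v k := by
      refine le_kthSmallest_of_card_lt (by simpa using hkn) (lt_of_le_of_lt (Finset.card_le_card
        (Finset.monotone_filter_right (q := fun k => w (Fin.natAdd n k) ∈ band (qtil - M * a))
          _ fun i _ hi => ?_)) ?_)
      · have := abs_sub_le_of_abs_sub_lt ((abs_sub_comm _ _).trans_lt
          (hclose (w (Fin.natAdd n i)).1)) hi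
        exact this.trans (by linarith)
      · rw [hk, Nat.lt_ceil]
        linarith [(abs_lt.mp hdevL).2]
    have hdist : |kthSmallest Finset.univ v k - q n| ≤ 2 * η n + ρ n / r + (M + 1) * a := by
      rw [abs_le] at horacle ⊢
      constructor <;> linarith
    change |2 * kthSmallest Finset.univ v k - 2 * q n| ≤ _
    rw [← mul_sub, abs_mul, abs_two, mul_assoc]
    refine mul_le_mul_of_nonneg_left (hdist.trans ?_) two_pos.le
    have := hηnn n
    have := hρnn n
    have : 0 ≤ 1 / r := by positivity
    rw [div_eq_mul_one_div (ρ n)]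
    have : 0 ≤ (M + 1 + 1 / r) * η n := by positivity
    have : 0 ≤ (2 + (M + 1)) * ρ n := by positivity
    have : 0 ≤ (2 + 1 / r) * a := by positivity
    linarith
  calc _ ≤ _ := measure_mono hsub
    _ ≤ ENNReal.ofReal (ε / 3) + ENNReal.ofReal (ε / 3) + ENNReal.ofReal (ε / 3) := by
      refine (measure_union_le _ _).trans (add_le_add ((measure_union_le _ _).trans
        (add_le_add ?_ ?_)) ?_)
      · exact (pi_preimage_castAdd_le P n n _).trans (hn.trans (ENNReal.ofReal_le_ofReal hρn))
      · exact (pi_preimage_natAdd_le P n n _).trans (hdev _)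
      · exact (pi_preimage_natAdd_le P n n _).trans (hdev _)
    _ = ENNReal.ofReal ε := by
      rw [← ENNReal.ofReal_add (by positivity) (by positivity),
        ← ENNReal.ofReal_add (by positivity) (by positivity)]
      congr 1
      ring
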